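/- arXiv:2112.04699 — 4 statements merged into one kernel-verified Lean document; each statement's English description precedes it below -/
import Mathlib

section
/- Let F : ℝⁿ → ℝⁿ be continuously differentiable, let M : ℝⁿ → ℝ^{n×n} be a continuous symmetric-matrix-valued function, and let 0 < α₁ ≤ α₂ be constants with α₁‖δ‖² ≤ δᵀM(x)δ ≤ α₂‖δ‖² for all x, δ ∈ ℝⁿ. Let β ∈ (0,1] and suppose the discrete-time contraction condition holds: for all x, δ ∈ ℝⁿ, (DF(x)δ)ᵀ M(F(x)) (DF(x)δ) ≤ (1-β) δᵀ M(x) δ, where DF(x) is the Fréchet derivative of F at x. Then the iterates of F are incrementally exponentially stable: for all x₀, x₀* ∈ ℝⁿ and all k ∈ ℕ, ‖F^[k](x₀) − F^[k](x₀*)‖ ≤ √(α₂/α₁) · (1−β)^{k/2} · ‖x₀ − x₀*‖ (where F^[k] denotes the k-fold iterate of F). -/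
open Matrix

/-- If `F : ℝⁿ → ℝⁿ` is C¹, `M` is a continuous symmetric matrix-valued
function uniformly bounded as `α₁ I ⪯ M(x) ⪯ α₂ I` (with `0 < α₁ ≤ α₂`), and the
discrete-time contraction condition with rate `β ∈ (0,1]` holds, then the iterates of `F`
are incrementally exponentially stable:
`‖F^[k] x₀ − F^[k] x₀*‖ ≤ √(α₂/α₁) (1−β)^(k/2) ‖x₀ − x₀*‖`. -/
theorem incremental_exponential_stability_of_contraction
    {n : ℕ} (F : EuclideanSpace ℝ (Fin n) → EuclideanSpace ℝ (Fin n))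
    (M : EuclideanSpace ℝ (Fin n) → Matrix (Fin n) (Fin n) ℝ)
    (hF : ContDiff ℝ 1 F) (hMcont : Continuous M) (hMsym : ∀ x, (M x).IsSymm)
    (α₁ α₂ : ℝ) (hα₁ : 0 < α₁) (hα₁₂ : α₁ ≤ α₂)
    (hMlow : ∀ (x δ : EuclideanSpace ℝ (Fin n)), α₁ * ‖δ‖ ^ 2 ≤ δ ⬝ᵥ (M x).mulVec δ)
    (hMup : ∀ (x δ : EuclideanSpace ℝ (Fin n)), δ ⬝ᵥ (M x).mulVec δ ≤ α₂ * ‖δ‖ ^ 2)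
    (β : ℝ) (hβ0 : 0 < β) (hβ1 : β ≤ 1)
    (hcontr : ∀ (x δ : EuclideanSpace ℝ (Fin n)),
      (fderiv ℝ F x δ) ⬝ᵥ (M (F x)).mulVec (fderiv ℝ F x δ)
        ≤ (1 - β) * (δ ⬝ᵥ (M x).mulVec δ)) :
    ∀ (x₀ x₀' : EuclideanSpace ℝ (Fin n)) (k : ℕ),
      ‖F^[k] x₀ - F^[k] x₀'‖ ≤
        Real.sqrt (α₂ / α₁) * (1 - β) ^ ((k : ℝ) / 2) * ‖x₀ - x₀'‖ := by
  have hb : 0 ≤ 1 - β := by linarith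
  have hd : ∀ k : ℕ, Differentiable ℝ (F^[k]) := fun k =>
    (hF.differentiable (by norm_num)).iterate k
  have key : ∀ (k : ℕ) (x δ : EuclideanSpace ℝ (Fin n)),
      (fderiv ℝ (F^[k]) x δ) ⬝ᵥ (M (F^[k] x)).mulVec (fderiv ℝ (F^[k]) x δ)
        ≤ (1 - β) ^ k * (δ ⬝ᵥ (M x).mulVec δ) := by
    intro k
    induction k with
    | zero => intro x δ; simp [Function.iterate_zero]
    | succ k ih =>
      intro x δ
      rw [Function.iterate_succ', fderiv_comp x
        ((hF.differentiable (by norm_num)) _) (hd k x)]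
      simp only [ContinuousLinearMap.comp_apply, Function.comp_apply]
      refine (hcontr _ _).trans ?_
      rw [pow_succ', mul_assoc]
      exact mul_le_mul_of_nonneg_left (ih x δ) hb
  intro x y k
  have hr : ((1 - β) ^ ((k : ℝ) / 2)) ^ 2 = (1 - β) ^ k := by
    rw [← Real.rpow_natCast, ← Real.rpow_mul hb, ← Real.rpow_natCast]
    congr 1
    push_cast
    ring
  have hr0 : 0 ≤ (1 - β) ^ ((k : ℝ) / 2) := Real.rpow_nonneg hb _
  have hC : 0 ≤ Real.sqrt (α₂ / α₁) * (1 - β) ^ ((k : ℝ) / 2) :=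
    mul_nonneg (Real.sqrt_nonneg _) hr0
  refine Convex.norm_image_sub_le_of_norm_fderiv_le (𝕜 := ℝ) (s := Set.univ)
    (fun z _ => hd k z) (fun z _ => ?_) convex_univ (Set.mem_univ y) (Set.mem_univ x)
  refine ContinuousLinearMap.opNorm_le_bound _ hC (fun δ => ?_)
  refine (sq_le_sq₀ (norm_nonneg _) (mul_nonneg hC (norm_nonneg _))).1 ?_
  rw [mul_pow, mul_pow, hr, Real.sq_sqrt (div_nonneg (hα₁.le.trans hα₁₂) hα₁.le)]
  have h1 := hMlow (F^[k] z) (fderiv ℝ (F^[k]) z δ)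
  have h2 := mul_le_mul_of_nonneg_left (hMup z δ) (pow_nonneg hb k)
  have h3 := (h1.trans (key k z δ)).trans h2
  have h4 : α₂ / α₁ * (1 - β) ^ k * ‖δ‖ ^ 2 = ((1 - β) ^ k * (α₂ * ‖δ‖ ^ 2)) / α₁ := by
    field_simp
  rw [h4, le_div_iff₀ hα₁]
  linarith
end

section
/- Let F : ℝⁿ → ℝⁿ be continuously differentiable, let M : ℝⁿ → ℝ^{n×n} be a continuous symmetric-matrix-valued function with α₁‖δ‖² ≤ δᵀM(x)δ ≤ α₂‖δ‖² for all x, δ (0 < α₁ ≤ α₂), and suppose the discrete-time contraction condition (DF(x)δ)ᵀ M(F(x)) (DF(x)δ) ≤ (1−β) δᵀ M(x) δ holds for all x, δ, with β ∈ (0,1). Then for any sampling period Δt > 0, setting λ := −ln(1−β)/(2Δt) > 0 and R := √(α₂/α₁), the iterates satisfy ‖F^[k](x₀) − F^[k](x₀*)‖ ≤ R · e^{−λ k Δt} · ‖x₀ − x₀*‖ for all x₀, x₀* ∈ ℝⁿ and k ∈ ℕ. -/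
open Matrix

/-- Under the uniform metric bounds and the discrete-time contraction
condition with rate `β ∈ (0,1)`, for any sampling period `Δt > 0`, setting
`λ := −ln(1−β)/(2Δt) > 0` and `R := √(α₂/α₁)`, the iterates satisfy
`‖F^[k] x₀ − F^[k] x₀*‖ ≤ R e^(−λ k Δt) ‖x₀ − x₀*‖`. -/
theorem incremental_exponential_stability_rate_form
    {n : ℕ} (F : EuclideanSpace ℝ (Fin n) → EuclideanSpace ℝ (Fin n))
    (M : EuclideanSpace ℝ (Fin n) → Matrix (Fin n) (Fin n) ℝ)
    (hF : ContDiff ℝ 1 F) (hMcont : Continuous M) (hMsym : ∀ x, (M x).IsSymm)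
    (α₁ α₂ : ℝ) (hα₁ : 0 < α₁) (hα₁₂ : α₁ ≤ α₂)
    (hMlow : ∀ (x δ : EuclideanSpace ℝ (Fin n)), α₁ * ‖δ‖ ^ 2 ≤ δ ⬝ᵥ (M x).mulVec δ)
    (hMup : ∀ (x δ : EuclideanSpace ℝ (Fin n)), δ ⬝ᵥ (M x).mulVec δ ≤ α₂ * ‖δ‖ ^ 2)
    (β : ℝ) (hβ0 : 0 < β) (hβ1 : β < 1)
    (hcontr : ∀ (x δ : EuclideanSpace ℝ (Fin n)),
      (fderiv ℝ F x δ) ⬝ᵥ (M (F x)).mulVec (fderiv ℝ F x δ)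
        ≤ (1 - β) * (δ ⬝ᵥ (M x).mulVec δ))
    (Δt : ℝ) (hΔt : 0 < Δt)
    (lam R : ℝ) (hlam : lam = -Real.log (1 - β) / (2 * Δt))
    (hR : R = Real.sqrt (α₂ / α₁)) :
    0 < lam ∧
      ∀ (x₀ x₀' : EuclideanSpace ℝ (Fin n)) (k : ℕ),
        ‖F^[k] x₀ - F^[k] x₀'‖ ≤
          R * Real.exp (-lam * k * Δt) * ‖x₀ - x₀'‖ := by
  have hd : Differentiable ℝ F := hF.differentiable (by norm_num)
  have hb : 0 < 1 - β := by linarith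
  have hlog : Real.log (1 - β) < 0 := Real.log_neg hb (by linarith)
  refine ⟨by rw [hlam]; apply div_pos <;> linarith, ?_⟩
  intro x₀ x₀' k
  have hdk : ∀ k : ℕ, Differentiable ℝ (F^[k]) := fun k => hd.iterate k
  have key : ∀ (k : ℕ) (x δ : EuclideanSpace ℝ (Fin n)),
      (fderiv ℝ (F^[k]) x δ) ⬝ᵥ (M (F^[k] x)).mulVec (fderiv ℝ (F^[k]) x δ)
        ≤ (1 - β) ^ k * (δ ⬝ᵥ (M x).mulVec δ) := by
    intro k
    induction k with
    | zero => intro x δ; simp [Function.iterate_zero]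
    | succ k ih =>
      intro x δ
      have h1 : fderiv ℝ (F^[k+1]) x δ = fderiv ℝ F (F^[k] x) (fderiv ℝ (F^[k]) x δ) := by
        rw [Function.iterate_succ', fderiv_comp x (hd _) (hdk k x)]
        rfl
      rw [h1, Function.iterate_succ_apply']
      refine (hcontr _ _).trans ?_
      rw [pow_succ', mul_assoc]
      exact mul_le_mul_of_nonneg_left (ih x δ) hb.le
  have hα₂ : 0 < α₂ := by linarith
  have hexp : Real.exp (-lam * k * Δt) ^ 2 = (1 - β) ^ k := by
    rw [← Real.exp_nat_mul, ← Real.exp_log (pow_pos hb k), Real.log_pow, hlam]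
    congr 1
    field_simp
    push_cast
    ring
  have hR2 : R ^ 2 = α₂ / α₁ := by rw [hR, Real.sq_sqrt (by positivity)]
  have hR0 : 0 ≤ R := by rw [hR]; positivity
  have hC : 0 ≤ R * Real.exp (-lam * k * Δt) := by positivity
  have hbound : ∀ x, ‖fderiv ℝ (F^[k]) x‖ ≤ R * Real.exp (-lam * k * Δt) := by
    intro x
    refine ContinuousLinearMap.opNorm_le_bound _ hC fun δ => ?_
    refine (sq_le_sq₀ (by positivity) (by positivity)).1 ?_
    rw [mul_pow, mul_pow, hR2, hexp]
    have h1 := (hMlow _ _).trans (key k x δ)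
    have h2 := mul_le_mul_of_nonneg_left (hMup x δ) (pow_pos hb k).le
    have h3 := h1.trans h2
    have h4 : α₂ / α₁ * (1 - β) ^ k * ‖δ‖ ^ 2 = ((1 - β) ^ k * (α₂ * ‖δ‖ ^ 2)) / α₁ := by
      field_simp
    rw [h4, le_div_iff₀ hα₁]
    linarith
  exact convex_univ.norm_image_sub_le_of_norm_fderiv_le (fun x _ => hdk k x)
    (fun x _ => hbound x) (Set.mem_univ x₀') (Set.mem_univ x₀)
end

section
/- Let F : ℝⁿ × ℝᵖ → ℝⁿ be continuously differentiable, let M : ℝⁿ → ℝ^{n×n} be a continuous symmetric-matrix-valued function with α₁‖δ‖² ≤ δᵀM(x)δ ≤ α₂‖δ‖² for all x, δ (0 < α₁ ≤ α₂), let β ∈ (0,1], let Q be a symmetric negative-semidefinite n×n matrix, S an n×p matrix, and R a symmetric p×p matrix. Suppose the exponential differential (Q,S,R)-dissipativity condition holds: for all x ∈ ℝⁿ, ν ∈ ℝᵖ, δx ∈ ℝⁿ, δν ∈ ℝᵖ, (D_xF(x,ν)δx + D_νF(x,ν)δν)ᵀ M(F(x,ν)) (D_xF(x,ν)δx + D_νF(x,ν)δν)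 − (1−β) δxᵀ M(x) δx ≤ δxᵀQδx + 2δxᵀSδν + δνᵀRδν. Then for any disturbance sequence (ν_k) in ℝᵖ and any two solutions x_{k+1} = F(x_k, ν_k) and x*_{k+1} = F(x*_k, ν_k) driven by the same disturbances, ‖x_k − x*_k‖ ≤ √(α₂/α₁) · (1−β)^{k/2} · ‖x₀ − x*₀‖ for all k ∈ ℕ. -/
open Matrix

/-- If `F : ℝⁿ × ℝᵖ → ℝⁿ` is C¹, `M` is a continuous symmetric
matrix-valued function uniformly bounded as `α₁ I ⪯ M(x) ⪯ α₂ I`, `β ∈ (0,1]`, `Q` is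
symmetric negative semidefinite, and the exponential differential (Q,S,R)-dissipativity
condition holds (with `D_xF δx + D_νF δν = DF(x,ν)(δx,δν)`), then any two solutions
driven by the same disturbance sequence satisfy
`‖x_k − x*_k‖ ≤ √(α₂/α₁) (1−β)^(k/2) ‖x₀ − x*₀‖`. -/
theorem dissipative_incremental_stability_same_disturbance
    {n p : ℕ}
    (F : EuclideanSpace ℝ (Fin n) × EuclideanSpace ℝ (Fin p) → EuclideanSpace ℝ (Fin n))
    (M : EuclideanSpace ℝ (Fin n) → Matrix (Fin n) (Fin n) ℝ)
    (hF : ContDiff ℝ 1 F) (hMcont : Continuous M) (hMsym : ∀ x, (M x).IsSymm)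
    (α₁ α₂ : ℝ) (hα₁ : 0 < α₁) (hα₁₂ : α₁ ≤ α₂)
    (hMlow : ∀ (x δ : EuclideanSpace ℝ (Fin n)), α₁ * ‖δ‖ ^ 2 ≤ δ ⬝ᵥ (M x).mulVec δ)
    (hMup : ∀ (x δ : EuclideanSpace ℝ (Fin n)), δ ⬝ᵥ (M x).mulVec δ ≤ α₂ * ‖δ‖ ^ 2)
    (β : ℝ) (hβ0 : 0 < β) (hβ1 : β ≤ 1)
    (Q : Matrix (Fin n) (Fin n) ℝ) (hQ : (-Q).PosSemidef)
    (S : Matrix (Fin n) (Fin p) ℝ) (R : Matrix (Fin p) (Fin p) ℝ) (hR : R.IsSymm)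
    (hdiss : ∀ (x : EuclideanSpace ℝ (Fin n)) (ν : EuclideanSpace ℝ (Fin p))
        (δx : EuclideanSpace ℝ (Fin n)) (δν : EuclideanSpace ℝ (Fin p)),
      (fderiv ℝ F (x, ν) (δx, δν)) ⬝ᵥ (M (F (x, ν))).mulVec (fderiv ℝ F (x, ν) (δx, δν))
          - (1 - β) * (δx ⬝ᵥ (M x).mulVec δx)
        ≤ δx ⬝ᵥ Q.mulVec δx + 2 * (δx ⬝ᵥ S.mulVec δν) + δν ⬝ᵥ R.mulVec δν)
    (ν : ℕ → EuclideanSpace ℝ (Fin p))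
    (x xs : ℕ → EuclideanSpace ℝ (Fin n))
    (hx : ∀ k, x (k + 1) = F (x k, ν k))
    (hxs : ∀ k, xs (k + 1) = F (xs k, ν k)) :
    ∀ k : ℕ, ‖x k - xs k‖ ≤
      Real.sqrt (α₂ / α₁) * (1 - β) ^ ((k : ℝ) / 2) * ‖x 0 - xs 0‖ := by
  classical
  have h1β : 0 ≤ 1 - β := by linarith
  let G : ℕ → EuclideanSpace ℝ (Fin n) → EuclideanSpace ℝ (Fin n) :=
    fun k y => Nat.rec y (fun j z => F (z, ν j)) k
  have hGs : ∀ k y, G (k + 1) y = F (G k y, ν k) := fun k y => rfl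
  have hG : ∀ (u : ℕ → EuclideanSpace ℝ (Fin n)), (∀ k, u (k + 1) = F (u k, ν k)) →
      ∀ k, u k = G k (u 0) := by
    intro u hu k
    induction k with
    | zero => rfl
    | succ k ih => rw [hu, hGs, ← ih]
  have hQ' : ∀ δ : EuclideanSpace ℝ (Fin n), δ ⬝ᵥ Q.mulVec δ ≤ 0 := by
    intro δ
    have h := hQ.dotProduct_mulVec_nonneg (δ : Fin n → ℝ)
    simp only [star_trivial, Matrix.neg_mulVec, dotProduct_neg] at h
    linarith
  have key : ∀ k y, ∃ L : EuclideanSpace ℝ (Fin n) →L[ℝ] EuclideanSpace ℝ (Fin n),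
      HasFDerivAt (G k) L y ∧ ∀ δ, (L δ) ⬝ᵥ (M (G k y)).mulVec (L δ) ≤
        (1 - β) ^ k * (δ ⬝ᵥ (M y).mulVec δ) := by
    intro k y
    induction k with
    | zero =>
      refine ⟨ContinuousLinearMap.id ℝ _, hasFDerivAt_id y, fun δ => ?_⟩
      simp [G]
    | succ k ih =>
      obtain ⟨L, hL, hb⟩ := ih
      have hFd : HasFDerivAt F (fderiv ℝ F (G k y, ν k)) (G k y, ν k) :=
        (hF.differentiable (by norm_num) _).hasFDerivAt
      have hp := hL.prodMk (hasFDerivAt_const (ν k) y)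
      refine ⟨_, HasFDerivAt.comp (f := fun z => (G k z, ν k)) y hFd hp, fun δ => ?_⟩
      have h := hdiss (G k y) (ν k) (L δ) 0
      have hq := hQ' (L δ)
      have h2 := mul_le_mul_of_nonneg_left (hb δ) h1β
      have h3 : (L δ) ⬝ᵥ S.mulVec (0 : EuclideanSpace ℝ (Fin p)) = 0 := by simp
      have h4 : (0 : EuclideanSpace ℝ (Fin p)) ⬝ᵥ
        R.mulVec (0 : EuclideanSpace ℝ (Fin p)) = 0 := by simp
      rw [h3, h4] at h
      change (fderiv ℝ F (G k y, ν k) (L δ, 0)) ⬝ᵥ (M (F (G k y, ν k))).mulVec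
        (fderiv ℝ F (G k y, ν k) (L δ, 0)) ≤ _
      rw [pow_succ]
      linarith
  intro k
  choose L hL hb using key k
  rw [hG x hx k, hG xs hxs k]
  have hC : (1 - β) ^ ((k : ℝ) / 2) = Real.sqrt ((1 - β) ^ k) := by
    rw [Real.sqrt_eq_rpow, ← Real.rpow_natCast, ← Real.rpow_mul h1β]
    congr 1; ring
  have hα₂ : 0 < α₂ := lt_of_lt_of_le hα₁ hα₁₂
  rw [hC]
  refine convex_univ.norm_image_sub_le_of_norm_hasFDerivWithin_le
    (fun y _ => (hL y).hasFDerivWithinAt) (fun y _ => ?_) (Set.mem_univ _) (Set.mem_univ _)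
  refine ContinuousLinearMap.opNorm_le_bound _ (by positivity) fun δ => ?_
  refine abs_le_of_sq_le_sq' ?_ (by positivity) |>.2
  rw [mul_pow, mul_pow, Real.sq_sqrt (by positivity), Real.sq_sqrt (by positivity)]
  have a := hMlow (G k y) (L y δ)
  have b := hb y δ
  have c := mul_le_mul_of_nonneg_left (hMup y δ) (pow_nonneg h1β k)
  rw [div_mul_eq_mul_div, div_mul_eq_mul_div, le_div_iff₀ hα₁]
  linarith
end

section
/- Let F : ℝⁿ × ℝᵖ → ℝⁿ be continuously differentiable, let M : ℝⁿ → ℝ^{n×n} be a continuous symmetric positive-semidefinite matrix-valued function, let β ∈ (0,1] and q, r > 0. Suppose that for all x ∈ ℝⁿ, ν ∈ ℝᵖ, δx ∈ ℝⁿ, δν ∈ ℝᵖ, (D_xF(x,ν)δx + D_νF(x,ν)δν)ᵀ M(F(x,ν)) (D_xF(x,ν)δx + D_νF(x,ν)δν) − (1−β) δxᵀ M(x) δx ≤ −q‖δx‖² + r‖δν‖². Then the system has truncated incremental ℓ₂ gain √(r/q): for any N ∈ ℕ, any disturbance sequences (ν_k), (ν*_k) in ℝᵖ, and any solutions x_{k+1}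 = F(x_k, ν_k), x*_{k+1} = F(x*_k, ν*_k) with equal initial conditions x₀ = x*₀, it holds that Σ_{k=0}^N ‖x_k − x*_k‖² ≤ (r/q) · Σ_{k=0}^N ‖ν_k − ν*_k‖². -/
open Matrix

theorem stacked_mvt {E : Type*} [NormedAddCommGroup E] [NormedSpace ℝ E] (N : ℕ)
    (X D : ℕ → ℝ → E) (hXD : ∀ k s, HasDerivAt (X k) (D k s) s) (C : ℝ) (hC0 : 0 ≤ C)
    (hbound : ∀ s, ∑ k ∈ Finset.range N, ‖D k s‖ ^ 2 ≤ C) :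
    ∑ k ∈ Finset.range N, ‖X k 1 - X k 0‖ ^ 2 ≤ C := by
  let Y : ℝ → PiLp 2 (fun _ : Fin N => E) :=
    fun s => WithLp.toLp 2 (fun k => X k s)
  let Y' : ℝ → PiLp 2 (fun _ : Fin N => E) :=
    fun s => WithLp.toLp 2 (fun k => D k s)
  have hY : ∀ s, HasDerivAt Y (Y' s) s := by
    intro s
    have h : HasDerivAt (fun s => fun k : Fin N => X k s) (fun k : Fin N => D k s) s :=
      hasDerivAt_pi.2 fun k => hXD k s
    exact ((PiLp.continuousLinearEquiv 2 ℝ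
      (fun _ : Fin N => E)).symm.hasFDerivAt).comp_hasDerivAt s h
  have hfin := norm_image_sub_le_of_norm_deriv_le_segment_01' (f := Y) (f' := Y') (C := √C)
    (fun s _ => (hY s).hasDerivWithinAt) (fun s _ => by
      apply Real.le_sqrt_of_sq_le
      rw [PiLp.norm_sq_eq_of_L2, Fin.sum_univ_eq_sum_range (fun k => ‖D k s‖ ^ 2)]
      exact hbound s)
  have h3 := (Real.le_sqrt (norm_nonneg _) hC0).1 hfin
  rw [PiLp.norm_sq_eq_of_L2] at h3
  rw [← Fin.sum_univ_eq_sum_range (fun k => ‖X k 1 - X k 0‖ ^ 2)]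
  exact h3

/-- Interpolated trajectory. -/
noncomputable def interpTraj {n p : ℕ}
    (F : EuclideanSpace ℝ (Fin n) × EuclideanSpace ℝ (Fin p) → EuclideanSpace ℝ (Fin n))
    (ν νs : ℕ → EuclideanSpace ℝ (Fin p)) (x0 : EuclideanSpace ℝ (Fin n)) :
    ℕ → ℝ → EuclideanSpace ℝ (Fin n)
  | 0, _ => x0
  | k + 1, s => F (interpTraj F ν νs x0 k s, νs k + s • (ν k - νs k))

/-- Its derivative. -/
noncomputable def interpDer {n p : ℕ}
    (F : EuclideanSpace ℝ (Fin n) × EuclideanSpace ℝ (Fin p) → EuclideanSpace ℝ (Fin n))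
    (ν νs : ℕ → EuclideanSpace ℝ (Fin p)) (x0 : EuclideanSpace ℝ (Fin n)) :
    ℕ → ℝ → EuclideanSpace ℝ (Fin n)
  | 0, _ => 0
  | k + 1, s => fderiv ℝ F (interpTraj F ν νs x0 k s, νs k + s • (ν k - νs k))
      (interpDer F ν νs x0 k s, ν k - νs k)

theorem interp_hasDerivAt {n p : ℕ}
    (F : EuclideanSpace ℝ (Fin n) × EuclideanSpace ℝ (Fin p) → EuclideanSpace ℝ (Fin n))
    (hF : ContDiff ℝ 1 F)
    (ν νs : ℕ → EuclideanSpace ℝ (Fin p)) (x0 : EuclideanSpace ℝ (Fin n)) (k : ℕ) (s : ℝ) :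
    HasDerivAt (interpTraj F ν νs x0 k) (interpDer F ν νs x0 k s) s := by
  induction k with
  | zero => exact hasDerivAt_const s x0
  | succ k ih =>
    have h2 : HasDerivAt (fun s : ℝ => νs k + s • (ν k - νs k)) (ν k - νs k) s := by
      simpa using ((hasDerivAt_id s).smul_const (ν k - νs k)).const_add (νs k)
    have hf := ((hF.differentiable one_ne_zero)
      (interpTraj F ν νs x0 k s, νs k + s • (ν k - νs k))).hasFDerivAt
    exact hf.comp_hasDerivAt s (ih.prodMk h2)

/-- If `F : ℝⁿ × ℝᵖ → ℝⁿ` is C¹, `M` is a continuous symmetric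
positive-semidefinite matrix-valued function, `β ∈ (0,1]`, `q, r > 0`, and the
exponential differential dissipativity condition holds with supply rate
`−q‖δx‖² + r‖δν‖²`, then the system has truncated incremental ℓ₂ gain `√(r/q)`:
for solutions with equal initial conditions,
`Σ_{k=0}^N ‖x_k − x*_k‖² ≤ (r/q) Σ_{k=0}^N ‖ν_k − ν*_k‖²`. -/
theorem truncated_incremental_l2_gain
    {n p : ℕ}
    (F : EuclideanSpace ℝ (Fin n) × EuclideanSpace ℝ (Fin p) → EuclideanSpace ℝ (Fin n))
    (M : EuclideanSpace ℝ (Fin n) → Matrix (Fin n) (Fin n) ℝ)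
    (hF : ContDiff ℝ 1 F) (hMcont : Continuous M) (hMpsd : ∀ x, (M x).PosSemidef)
    (β : ℝ) (hβ0 : 0 < β) (hβ1 : β ≤ 1)
    (q r : ℝ) (hq : 0 < q) (hr : 0 < r)
    (hdiss : ∀ (x : EuclideanSpace ℝ (Fin n)) (ν : EuclideanSpace ℝ (Fin p))
        (δx : EuclideanSpace ℝ (Fin n)) (δν : EuclideanSpace ℝ (Fin p)),
      (fderiv ℝ F (x, ν) (δx, δν)) ⬝ᵥ (M (F (x, ν))).mulVec (fderiv ℝ F (x, ν) (δx, δν))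
          - (1 - β) * (δx ⬝ᵥ (M x).mulVec δx)
        ≤ -q * ‖δx‖ ^ 2 + r * ‖δν‖ ^ 2)
    (N : ℕ) (ν νs : ℕ → EuclideanSpace ℝ (Fin p))
    (x xs : ℕ → EuclideanSpace ℝ (Fin n))
    (hx : ∀ k, x (k + 1) = F (x k, ν k))
    (hxs : ∀ k, xs (k + 1) = F (xs k, νs k))
    (h0 : x 0 = xs 0) :
    ∑ k ∈ Finset.range (N + 1), ‖x k - xs k‖ ^ 2
      ≤ (r / q) * ∑ k ∈ Finset.range (N + 1), ‖ν k - νs k‖ ^ 2 := by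
  set X := interpTraj F ν νs (x 0) with hX
  set D := interpDer F ν νs (x 0) with hD
  have hX1 : ∀ k, X k 1 = x k := by
    intro k
    induction k with
    | zero => rfl
    | succ k ih =>
      have : X (k+1) 1 = F (X k 1, νs k + (1:ℝ) • (ν k - νs k)) := rfl
      rw [this, ih, hx]; simp
  have hX0 : ∀ k, X k 0 = xs k := by
    intro k
    induction k with
    | zero => exact h0
    | succ k ih =>
      have : X (k+1) 0 = F (X k 0, νs k + (0:ℝ) • (ν k - νs k)) := rfl
      rw [this, ih, hxs]; simp
  have hVnn : ∀ y (v : EuclideanSpace ℝ (Fin n)), 0 ≤ v ⬝ᵥ (M y).mulVec v := by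
    intro y v
    simpa using (hMpsd y).dotProduct_mulVec_nonneg v.ofLp
  have key : ∀ s m, (D m s) ⬝ᵥ (M (X m s)).mulVec (D m s)
      + q * ∑ k ∈ Finset.range m, ‖D k s‖ ^ 2 ≤ r * ∑ k ∈ Finset.range m, ‖ν k - νs k‖ ^ 2 := by
    intro s m
    induction m with
    | zero =>
      have : D 0 s = 0 := rfl
      simp [this]
    | succ m ih =>
      have h := hdiss (X m s) (νs m + s • (ν m - νs m)) (D m s) (ν m - νs m)
      have e1 : X (m+1) s = F (X m s, νs m + s • (ν m - νs m)) := rfl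
      have e2 : D (m+1) s = fderiv ℝ F (X m s, νs m + s • (ν m - νs m)) (D m s, ν m - νs m) := rfl
      rw [← e1, ← e2] at h
      rw [Finset.sum_range_succ, Finset.sum_range_succ]
      have := mul_nonneg hβ0.le (hVnn (X m s) (D m s))
      linarith
  set C := (r / q) * ∑ k ∈ Finset.range (N + 1), ‖ν k - νs k‖ ^ 2 with hC
  have hC0 : 0 ≤ C := by positivity
  have hbound : ∀ s, ∑ k ∈ Finset.range (N + 1), ‖D k s‖ ^ 2 ≤ C := by
    intro s
    have h1 := key s (N+1)
    have h2 := hVnn (X (N+1) s) (D (N+1) s)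
    rw [hC, div_mul_eq_mul_div, le_div_iff₀ hq]
    linarith
  have h3 := stacked_mvt (N+1) X D (interp_hasDerivAt F hF ν νs (x 0)) C hC0 hbound
  simpa only [hX1, hX0] using h3
end
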